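/- arXiv:1503.01447 — 2 statements merged into one kernel-verified Lean document; each statement's English description precedes it below -/
import Mathlib

section
/- Let s and r be coprime positive integers and let p ∈ ℂ[x,y] be weighted-homogeneous of degree d ≥ 1 with respect to the weights deg x = s, deg y = r, and suppose p is square-free. Then the ideal (∂p/∂x, ∂p/∂y) of ℂ[x,y] is homogeneous for the weighted grading, every graded piece of the quotient Q = ℂ[x,y]/(∂p/∂x, ∂p/∂y) is finite-dimensional, and the identity (1 − t^s)(1 − t^r) · t^{s+r} · Σ_{m ≥ 0} dim_ℂ Q[m] · t^m = (t^s − t^d)(t^r − t^d) holds in ℤ⟦t⟧, where Q[m] denotes the degree-m graded piece of Q. -/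
noncomputable section

/-- The weights: deg x = s, deg y = r (x = X 0, y = X 1). -/
def wt (s r : ℕ) : Fin 2 → ℕ := fun i => if i = 0 then s else r

/-- The ideal (∂p/∂x, ∂p/∂y) of ℂ[x,y]. -/
def jacIdeal (p : MvPolynomial (Fin 2) ℂ) : Ideal (MvPolynomial (Fin 2) ℂ) :=
  Ideal.span {MvPolynomial.pderiv (0 : Fin 2) p, MvPolynomial.pderiv (1 : Fin 2) p}

/-- The degree-m graded piece of Q = ℂ[x,y]/(∂p/∂x, ∂p/∂y), i.e. the image of the
degree-m weighted-homogeneous component of ℂ[x,y]. -/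
def Qpiece (s r : ℕ) (p : MvPolynomial (Fin 2) ℂ) (m : ℕ) :
    Submodule ℂ (MvPolynomial (Fin 2) ℂ ⧸ jacIdeal p) :=
  (MvPolynomial.weightedHomogeneousSubmodule ℂ (wt s r) m).map
    (Ideal.Quotient.mkₐ ℂ (jacIdeal p)).toLinearMap

namespace MvPolynomial

section GradedPart

variable {σ K : Type*} [Field K]

/-- The degree-`m` part of an ideal of a weighted polynomial ring. -/
def gradedPart (w : σ → ℕ) (I : Ideal (MvPolynomial σ K)) (m : ℕ) :
    Submodule K (MvPolynomial σ K) :=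
  weightedHomogeneousSubmodule K w m ⊓ I.restrictScalars K

/-- The Hilbert series of an ideal of a weighted polynomial ring. -/
def hilbertSeries (w : σ → ℕ) (I : Ideal (MvPolynomial σ K)) : PowerSeries ℤ :=
  PowerSeries.mk fun m => (Module.finrank K (gradedPart w I m) : ℤ)

variable {w : σ → ℕ} {I J : Ideal (MvPolynomial σ K)} {f g h : MvPolynomial σ K} {m e e' : ℕ}

attribute [local instance] weightedGradedAlgebra

theorem mem_gradedPart : h ∈ gradedPart w I m ↔ h.IsWeightedHomogeneous w m ∧ h ∈ I :=
  Iff.rfl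

theorem gradedPart_le_gradedPart_top : gradedPart w I m ≤ gradedPart w ⊤ m :=
  fun _ hx => ⟨hx.1, trivial⟩

theorem gradedPart_top : gradedPart w (⊤ : Ideal (MvPolynomial σ K)) m =
    weightedHomogeneousSubmodule K w m :=
  le_antisymm (fun _ hx => hx.1) fun _ hx => ⟨hx, trivial⟩

theorem gradedPart_inf : gradedPart w (I ⊓ J) m = gradedPart w I m ⊓ gradedPart w J m := by
  ext x
  simp only [mem_gradedPart, Submodule.mem_inf]
  tauto

theorem isHomogeneous_span_singleton (hf : f.IsWeightedHomogeneous w e) :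
    (Ideal.span {f}).IsHomogeneous (weightedHomogeneousSubmodule K w) :=
  Ideal.homogeneous_span _ _ (by rintro _ rfl; exact ⟨e, hf⟩)

theorem isHomogeneous_span_pair (hf : f.IsWeightedHomogeneous w e)
    (hg : g.IsWeightedHomogeneous w e') :
    (Ideal.span {f, g}).IsHomogeneous (weightedHomogeneousSubmodule K w) :=
  Ideal.homogeneous_span _ _ (by rintro _ (rfl | rfl); exacts [⟨e, hf⟩, ⟨e', hg⟩])

theorem gradedPart_sup (hI : I.IsHomogeneous (weightedHomogeneousSubmodule K w))
    (hJ : J.IsHomogeneous (weightedHomogeneousSubmodule K w)) :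
    gradedPart w (I ⊔ J) m = gradedPart w I m ⊔ gradedPart w J m := by
  apply le_antisymm
  · rintro x ⟨hx, hxIJ⟩
    obtain ⟨a, ha, b, hb, rfl⟩ := Submodule.mem_sup.mp hxIJ
    rw [← weightedHomogeneousComponent_eq_self hx, map_add]
    exact Submodule.add_mem_sup
      ⟨weightedHomogeneousComponent_isWeightedHomogeneous ..,
        weightedHomogeneousComponent_mem_of_mem K w hI ha m⟩
      ⟨weightedHomogeneousComponent_isWeightedHomogeneous ..,
        weightedHomogeneousComponent_mem_of_mem K w hJ hb m⟩
  · exact sup_le (fun x hx => ⟨hx.1, Ideal.mem_sup_left hx.2⟩)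
      fun x hx => ⟨hx.1, Ideal.mem_sup_right hx.2⟩

theorem weightedHomogeneousComponent_mul_left (hf : f.IsWeightedHomogeneous w e) :
    weightedHomogeneousComponent w m (f * g) =
      if e ≤ m then f * weightedHomogeneousComponent w (m - e) g else 0 := by
  simp_rw [← weightedDecomposition.decompose'_apply]
  exact DirectSum.coe_decompose_mul_of_left_mem (weightedHomogeneousSubmodule K w) m hf

theorem gradedPart_span_singleton (hf : f.IsWeightedHomogeneous w e) :
    gradedPart w (Ideal.span {f}) m =
      if e ≤ m then (gradedPart w ⊤ (m - e)).map (LinearMap.mulLeft K f) else ⊥ := by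
  apply le_antisymm
  · rintro x ⟨hx, hxf⟩
    obtain ⟨c, rfl⟩ := Ideal.mem_span_singleton.mp hxf
    rw [← weightedHomogeneousComponent_eq_self hx, weightedHomogeneousComponent_mul_left hf]
    split_ifs
    · exact ⟨_, ⟨weightedHomogeneousComponent_isWeightedHomogeneous .., trivial⟩, rfl⟩
    · exact zero_mem _
  · split_ifs with hem
    · rintro _ ⟨c, hc, rfl⟩
      refine ⟨?_, Ideal.mul_mem_right _ _ (Ideal.mem_span_singleton_self f)⟩
      have := hf.mul hc.1
      rwa [Nat.add_sub_cancel' hem] at this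
    · exact bot_le

theorem hilbertSeries_span_singleton (hf : f.IsWeightedHomogeneous w e) (hf0 : f ≠ 0) :
    hilbertSeries w (Ideal.span {f}) =
      PowerSeries.X ^ e * hilbertSeries w (⊤ : Ideal (MvPolynomial σ K)) := by
  ext m
  rw [PowerSeries.coeff_X_pow_mul', hilbertSeries, PowerSeries.coeff_mk,
    gradedPart_span_singleton hf]
  split_ifs with hem
  · rw [hilbertSeries, PowerSeries.coeff_mk, if_pos hem, ← (Submodule.equivMapOfInjective
      (LinearMap.mulLeft K f) (mul_right_injective₀ hf0) (gradedPart w ⊤ (m - e))).finrank_eq]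
  · rw [if_neg hem, finrank_bot, Nat.cast_zero]

variable [Finite σ]

theorem finiteDimensional_gradedPart (hw : ∀ i, w i ≠ 0) :
    FiniteDimensional K (gradedPart w I m) := by
  have : FiniteDimensional K (weightedHomogeneousSubmodule K w m) :=
    Module.Finite.iff_fg.mpr (weightedHomogeneousSubmodule_fg K w hw m)
  exact Submodule.finiteDimensional_of_le inf_le_left

theorem hilbertSeries_sup_add_inf (hw : ∀ i, w i ≠ 0)
    (hI : I.IsHomogeneous (weightedHomogeneousSubmodule K w))
    (hJ : J.IsHomogeneous (weightedHomogeneousSubmodule K w)) :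
    hilbertSeries w (I ⊔ J) + hilbertSeries w (I ⊓ J) =
      hilbertSeries w I + hilbertSeries w J := by
  ext m
  have := finiteDimensional_gradedPart (I := I) (m := m) hw
  have := finiteDimensional_gradedPart (I := J) (m := m) hw
  simp only [hilbertSeries, map_add, PowerSeries.coeff_mk]
  rw [gradedPart_sup hI hJ, gradedPart_inf]
  exact_mod_cast Submodule.finrank_sup_add_finrank_inf_eq (gradedPart w I m) (gradedPart w J m)

theorem hilbertSeries_span_pair (hw : ∀ i, w i ≠ 0) (hf : f.IsWeightedHomogeneous w e)
    (hg : g.IsWeightedHomogeneous w e') (hf0 : f ≠ 0) (hg0 : g ≠ 0) (hfg : IsRelPrime f g) :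
    hilbertSeries w (⊤ : Ideal (MvPolynomial σ K)) - hilbertSeries w (Ideal.span {f, g}) =
      (1 - PowerSeries.X ^ e) * (1 - PowerSeries.X ^ e') *
        hilbertSeries w (⊤ : Ideal (MvPolynomial σ K)) := by
  have hinf : Ideal.span {f} ⊓ Ideal.span {g} = Ideal.span {f * g} := by
    ext x
    simp only [Submodule.mem_inf, Ideal.mem_span_singleton]
    exact ⟨fun hx => hfg.mul_dvd hx.1 hx.2,
      fun hx => ⟨dvd_of_mul_right_dvd hx, dvd_of_mul_left_dvd hx⟩⟩
  have := hilbertSeries_sup_add_inf hw (isHomogeneous_span_singleton hf)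
    (isHomogeneous_span_singleton hg)
  rw [hinf, hilbertSeries_span_singleton hf hf0, hilbertSeries_span_singleton hg hg0,
    hilbertSeries_span_singleton (hf.mul hg) (mul_ne_zero hf0 hg0), ← Ideal.span_insert] at this
  linear_combination -this

theorem finrank_map_mk_gradedPart (hw : ∀ i, w i ≠ 0) :
    (Module.finrank K ((weightedHomogeneousSubmodule K w m).map
      (Ideal.Quotient.mkₐ K I).toLinearMap) : ℤ) =
      Module.finrank K (gradedPart w (⊤ : Ideal (MvPolynomial σ K)) m) -
        Module.finrank K (gradedPart w I m) := by
  have := finiteDimensional_gradedPart (K := K) (I := ⊤) (m := m) hw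
  rw [gradedPart_top] at this ⊢
  set V := weightedHomogeneousSubmodule K w m
  set φ := (Ideal.Quotient.mkₐ K I).toLinearMap
  have key := (φ.domRestrict V).finrank_range_add_finrank_ker
  have hker : (LinearMap.ker (φ.domRestrict V)).map V.subtype = gradedPart w I m := by
    ext x
    simp only [Submodule.mem_map, LinearMap.mem_ker, LinearMap.domRestrict_apply,
      Submodule.subtype_apply, Subtype.exists, mem_gradedPart]
    constructor
    · rintro ⟨y, hy, hyI, rfl⟩
      exact ⟨hy, Ideal.Quotient.eq_zero_iff_mem.mp hyI⟩
    · rintro ⟨hx, hxI⟩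
      exact ⟨x, hx, Ideal.Quotient.eq_zero_iff_mem.mpr hxI, rfl⟩
  rw [LinearMap.range_domRestrict] at key
  rw [← hker, Submodule.finrank_map_subtype_eq]
  omega

end GradedPart

theorem isRelPrime_X {σ K : Type*} [Field K] {i j : σ} (hij : i ≠ j) :
    IsRelPrime (X i : MvPolynomial σ K) (X j) := by
  rw [(X_prime (i := i)).irreducible.isRelPrime_iff_not_dvd, X_dvd_X]
  simpa using hij

theorem IsWeightedHomogeneous.mem_span_X_pair {K : Type*} [Field K] {w : Fin 2 → ℕ} {m : ℕ}
    (hm : m ≠ 0) {f : MvPolynomial (Fin 2) K} (hf : f.IsWeightedHomogeneous w m) :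
    f ∈ Ideal.span {(X 0 : MvPolynomial (Fin 2) K), X 1} := by
  have : ({X 0, X 1} : Set (MvPolynomial (Fin 2) K)) = X '' Set.univ := by
    ext; simp [Fin.exists_fin_two, eq_comm]
  rw [this, mem_ideal_span_X_image]
  intro d hd
  by_contra! hd0
  have hd0 : d = 0 := by ext i; exact hd0 i trivial
  have := hf (mem_support_iff.mp hd)
  simp [hd0] at this
  exact hm this.symm

theorem hilbertSeries_top_mul {K : Type*} [Field K] {w : Fin 2 → ℕ} (hw : ∀ i, w i ≠ 0) :
    (1 - PowerSeries.X ^ w 0) * (1 - PowerSeries.X ^ w 1) *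
      hilbertSeries w (⊤ : Ideal (MvPolynomial (Fin 2) K)) = 1 := by
  rw [← hilbertSeries_span_pair hw (isWeightedHomogeneous_X K w 0)
    (isWeightedHomogeneous_X K w 1) (X_ne_zero 0) (X_ne_zero 1) (isRelPrime_X (by decide))]
  ext m
  rw [map_sub, hilbertSeries, hilbertSeries, PowerSeries.coeff_mk, PowerSeries.coeff_mk,
    PowerSeries.coeff_one]
  split_ifs with hm
  · subst hm
    have h1 : gradedPart w (⊤ : Ideal (MvPolynomial (Fin 2) K)) 0 = Submodule.span K {1} := by
      ext x
      rw [Submodule.mem_span_singleton, gradedPart_top, mem_weightedHomogeneousSubmodule]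
      constructor
      · intro hx
        refine ⟨coeff 0 x, ?_⟩
        rw [← weightedHomogeneousComponent_eq_self hx, weightedHomogeneousComponent_zero _ hw]
        simp [smul_eq_C_mul]
      · rintro ⟨c, rfl⟩
        rw [smul_eq_C_mul, mul_one]
        exact isWeightedHomogeneous_C w c
    have h2 : gradedPart w (Ideal.span {(X 0 : MvPolynomial (Fin 2) K), X 1}) 0 = ⊥ := by
      rw [eq_bot_iff]
      intro x hx
      have hx' := h1.le (gradedPart_le_gradedPart_top hx)
      obtain ⟨c, rfl⟩ := Submodule.mem_span_singleton.mp hx'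
      obtain ⟨a, b, hab⟩ := Ideal.mem_span_pair.mp hx.2
      have := congrArg (eval 0) hab
      simp [smul_eq_C_mul] at this
      simp [this]
    rw [h1, h2, finrank_span_singleton one_ne_zero, finrank_bot]
    simp
  · have : gradedPart w (Ideal.span {(X 0 : MvPolynomial (Fin 2) K), X 1}) m =
        gradedPart w ⊤ m :=
      le_antisymm gradedPart_le_gradedPart_top
        fun x hx => ⟨hx.1, hx.1.mem_span_X_pair hm⟩
    rw [this, sub_self]

section Derivative

variable {σ K : Type*} [Field K]

theorem totalDegree_pderiv_lt {i : σ} {q : MvPolynomial σ K} (h : pderiv i q ≠ 0) :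
    (pderiv i q).totalDegree < q.totalDegree := by
  have hlt : ∀ m ∈ (pderiv i q).support, (m.sum fun _ e => e) < q.totalDegree := by
    intro m hm
    rw [mem_support_iff, coeff_pderiv] at hm
    have := le_totalDegree (mem_support_iff.mpr (left_ne_zero_of_mul hm))
    rw [Finsupp.sum_add_index' (fun _ => rfl) (fun _ _ _ => rfl),
      Finsupp.sum_single_index rfl] at this
    omega
  obtain ⟨m, hm⟩ := support_nonempty.mpr h
  exact (Finset.sup_lt_iff (Nat.zero_lt_of_lt (hlt m hm))).mpr hlt

theorem eq_C_of_pderiv_eq_zero [CharZero K] {q : MvPolynomial σ K}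
    (h : ∀ i, pderiv i q = 0) : q = C (coeff 0 q) := by
  classical
  ext m
  rw [coeff_C]
  split_ifs with hm
  · rw [hm]
  · obtain ⟨i, hi⟩ := Finsupp.ne_iff.mp (Ne.symm hm)
    have := congrArg (coeff (m - Finsupp.single i 1)) (h i)
    rw [coeff_pderiv, Finsupp.sub_add_single_one_cancel hi, coeff_zero] at this
    exact (mul_eq_zero.mp this).resolve_right (Nat.cast_add_one_ne_zero _)

theorem exists_not_dvd_pderiv [CharZero K] {p q : MvPolynomial σ K} (hp : Squarefree p)
    (hq : Prime q) (hqp : q ∣ p) : ∃ i, ¬ q ∣ pderiv i p := by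
  by_contra! hdvd
  obtain ⟨h, rfl⟩ := hqp
  have hqh : ¬ q ∣ h := fun ⟨c, hc⟩ =>
    hq.not_isUnit (hp q ⟨c, by rw [hc, mul_assoc]⟩)
  have hzero (i : σ) : pderiv i q = 0 := by
    by_contra hne
    have := hdvd i
    rw [pderiv_mul, dvd_add_left (dvd_mul_right q _)] at this
    have := totalDegree_le_of_dvd_of_isDomain ((hq.dvd_or_dvd this).resolve_right hqh) hne
    exact (totalDegree_pderiv_lt hne).not_ge this
  have hC := eq_C_of_pderiv_eq_zero hzero
  refine hq.not_isUnit ?_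
  rw [hC]
  refine IsUnit.map C (isUnit_iff_ne_zero.mpr fun h0 => hq.ne_zero ?_)
  rw [hC, h0, map_zero]

theorem IsWeightedHomogeneous.exists_pderiv {w : σ → ℕ} {d : ℕ} {p : MvPolynomial σ K} {i : σ}
    (hp : p.IsWeightedHomogeneous w d) (h : pderiv i p ≠ 0) :
    ∃ e, e + w i = d ∧ (pderiv i p).IsWeightedHomogeneous w e := by
  obtain ⟨m, hm⟩ := ne_zero_iff.mp h
  rw [coeff_pderiv] at hm
  have := hp (left_ne_zero_of_mul hm)
  rw [map_add, Finsupp.weight_single, one_smul] at this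
  exact ⟨_, this, hp.pderiv this⟩

theorem IsWeightedHomogeneous.weight_eq_of_isUnit_pderiv {w : σ → ℕ} {d : ℕ}
    {p : MvPolynomial σ K} {i : σ} (hp : p.IsWeightedHomogeneous w d)
    (h : IsUnit (pderiv i p)) : w i = d := by
  have h0 : coeff 0 (pderiv i p) ≠ 0 := (h.map constantCoeff).ne_zero
  rw [coeff_pderiv] at h0
  have := hp (left_ne_zero_of_mul h0)
  rwa [zero_add, Finsupp.weight_single, one_smul] at this

end Derivative

theorem IsWeightedHomogeneous.isRelPrime_pderiv {K : Type*} [Field K] [CharZero K]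
    {w : Fin 2 → ℕ} {d : ℕ} (hd : d ≠ 0) {p : MvPolynomial (Fin 2) K}
    (hp : p.IsWeightedHomogeneous w d) (hsf : Squarefree p) :
    IsRelPrime (pderiv 0 p) (pderiv 1 p) := by
  have heuler := hp.sum_weight_X_mul_pderiv
  rw [Fin.sum_univ_two] at heuler
  have hdvd {c : MvPolynomial (Fin 2) K} (h0 : c ∣ pderiv 0 p) (h1 : c ∣ pderiv 1 p) :
      c ∣ p := by
    have : c ∣ d • p := heuler ▸ dvd_add (dvd_smul_of_dvd _ (h0.mul_left _))
      (dvd_smul_of_dvd _ (h1.mul_left _))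
    have hu : IsUnit ((d : MvPolynomial (Fin 2) K)) := by
      rw [← map_natCast C]
      exact (Nat.cast_ne_zero.mpr hd).isUnit.map C
    rwa [nsmul_eq_mul, hu.dvd_mul_left] at this
  intro c h0 h1
  by_contra hc
  have hc0 : c ≠ 0 := ne_zero_of_dvd_ne_zero hsf.ne_zero (hdvd h0 h1)
  obtain ⟨q, hq, hqc⟩ := WfDvdMonoid.exists_irreducible_factor hc hc0
  obtain ⟨i, hi⟩ := exists_not_dvd_pderiv hsf hq.prime (hqc.trans (hdvd h0 h1))
  fin_cases i
  · exact hi (hqc.trans h0)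
  · exact hi (hqc.trans h1)

end MvPolynomial

open PowerSeries in
/-- for s, r coprime positive integers and p ∈ ℂ[x,y] weighted-homogeneous
of degree d ≥ 1 and square-free, the ideal (∂p/∂x, ∂p/∂y) is homogeneous for the weighted
grading (every weighted-homogeneous component of any of its elements lies in it), every
graded piece of Q = ℂ[x,y]/(∂p/∂x, ∂p/∂y) is finite-dimensional, and
(1 − t^s)(1 − t^r)·t^{s+r}·Σ dim Q[m] t^m = (t^s − t^d)(t^r − t^d) in ℤ⟦t⟧. -/
theorem stmt3 (s r : ℕ) (hs : 0 < s) (hr : 0 < r) (hco : Nat.Coprime s r)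
    (d : ℕ) (hd : 1 ≤ d) (p : MvPolynomial (Fin 2) ℂ)
    (hhom : p.IsWeightedHomogeneous (wt s r) d) (hsf : Squarefree p) :
    (∀ f ∈ jacIdeal p, ∀ m : ℕ,
        MvPolynomial.weightedHomogeneousComponent (wt s r) m f ∈ jacIdeal p) ∧
    (∀ m : ℕ, FiniteDimensional ℂ ↥(Qpiece s r p m)) ∧
    (1 - (X : PowerSeries ℤ) ^ s) * (1 - (X : PowerSeries ℤ) ^ r) *
        (X : PowerSeries ℤ) ^ (s + r) *
        (PowerSeries.mk fun m => (Module.finrank ℂ ↥(Qpiece s r p m) : ℤ)) =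
      ((X : PowerSeries ℤ) ^ s - (X : PowerSeries ℤ) ^ d) *
        ((X : PowerSeries ℤ) ^ r - (X : PowerSeries ℤ) ^ d) := by
  have hw : ∀ i, wt s r i ≠ 0 := by
    intro i
    fin_cases i
    · exact hs.ne'
    · exact hr.ne'
  have hrel := hhom.isRelPrime_pderiv (by omega) hsf
  have hser : (PowerSeries.mk fun m => (Module.finrank ℂ ↥(Qpiece s r p m) : ℤ)) =
      MvPolynomial.hilbertSeries (wt s r) (⊤ : Ideal (MvPolynomial (Fin 2) ℂ)) -
        MvPolynomial.hilbertSeries (wt s r) (jacIdeal p) := by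
    ext m
    exact MvPolynomial.finrank_map_mk_gradedPart hw
  have hunit : IsUnit (MvPolynomial.pderiv 0 p) ∨ IsUnit (MvPolynomial.pderiv 1 p) →
      jacIdeal p = ⊤ ∧ (s = d ∨ r = d) := by
    rintro (h | h)
    · exact ⟨Ideal.eq_top_of_isUnit_mem _ (Ideal.subset_span (by simp)) h,
        .inl (hhom.weight_eq_of_isUnit_pderiv h)⟩
    · exact ⟨Ideal.eq_top_of_isUnit_mem _ (Ideal.subset_span (by simp)) h,
        .inr (hhom.weight_eq_of_isUnit_pderiv h)⟩
  have hcases : (jacIdeal p = ⊤ ∧ (s = d ∨ r = d)) ∨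
      (MvPolynomial.pderiv 0 p ≠ 0 ∧ MvPolynomial.pderiv 1 p ≠ 0) := by
    by_cases h0 : MvPolynomial.pderiv 0 p = 0
    · rw [h0, isRelPrime_zero_left] at hrel
      exact .inl (hunit (.inr hrel))
    by_cases h1 : MvPolynomial.pderiv 1 p = 0
    · rw [h1, isRelPrime_zero_right] at hrel
      exact .inl (hunit (.inl hrel))
    exact .inr ⟨h0, h1⟩
  refine ⟨fun f hf m => ?_, fun m => ?_, ?_⟩
  · rcases hcases with ⟨htop, -⟩ | ⟨h0, h1⟩
    · rw [htop]
      trivial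
    · obtain ⟨e, -, hf0⟩ := hhom.exists_pderiv h0
      obtain ⟨e', -, hf1⟩ := hhom.exists_pderiv h1
      exact MvPolynomial.weightedHomogeneousComponent_mem_of_mem ℂ _
        (MvPolynomial.isHomogeneous_span_pair hf0 hf1) hf m
  · have := MvPolynomial.finiteDimensional_gradedPart (K := ℂ) (I := ⊤) (m := m) hw
    rw [MvPolynomial.gradedPart_top] at this
    exact Module.Finite.map _ _
  · rw [hser]
    rcases hcases with ⟨htop, hd'⟩ | ⟨h0, h1⟩
    · rw [htop, sub_self, mul_zero]
      rcases hd' with rfl | rfl <;> simp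
    · obtain ⟨e, he, hf0⟩ := hhom.exists_pderiv h0
      obtain ⟨e', he', hf1⟩ := hhom.exists_pderiv h1
      have htop := MvPolynomial.hilbertSeries_top_mul (K := ℂ) hw
      have hw0 : wt s r 0 = s := rfl
      have hw1 : wt s r 1 = r := rfl
      rw [hw0, hw1] at htop
      have hJ := MvPolynomial.hilbertSeries_span_pair hw hf0 hf1 h0 h1 hrel
      rw [hw0] at he
      rw [hw1] at he'
      rw [jacIdeal, hJ]
      generalize MvPolynomial.hilbertSeries (wt s r) (⊤ : Ideal (MvPolynomial (Fin 2) ℂ)) = H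
        at htop
      have hXs : (X : PowerSeries ℤ) ^ d = X ^ e * X ^ s := by rw [← he, pow_add]
      have hXr : (X : PowerSeries ℤ) ^ d = X ^ e' * X ^ r := by rw [← he', pow_add]
      calc _ = X ^ s * (1 - X ^ e) * (X ^ r * (1 - X ^ e')) * ((1 - X ^ s) * (1 - X ^ r) *
            H) := by ring
        _ = (X ^ s - X ^ e * X ^ s) * (X ^ r - X ^ e' * X ^ r) := by rw [htop]; ring
        _ = _ := by rw [← hXs, ← hXr]
end
end

section
/- There is a ℂ-linear isomorphism from B_2(ℂ⟨x,y⟩) to the polynomial ring ℂ[x,y] (viewed as a ℂ-vector space) which, for all integers i, j ≥ 1, sends the class of the commutator [x^i, y^j] to the polynomial i·j·x^{i−1}·y^{j−1}. -/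
noncomputable section

/-- The free associative unital ℂ-algebra on two generators x, y. -/
abbrev F2 : Type := FreeAlgebra ℂ (Fin 2)

/-- The abelianization homomorphism ℂ⟨x,y⟩ → ℂ[x,y], x ↦ x, y ↦ y. -/
def abmap : F2 →ₐ[ℂ] MvPolynomial (Fin 2) ℂ :=
  FreeAlgebra.lift ℂ (fun i => MvPolynomial.X i)

/-- The relation P = 0; `RingQuot (Prel P)` is the quotient of ℂ⟨x,y⟩ by the
two-sided ideal generated by P. -/
def Prel (P : F2) : F2 → F2 → Prop := fun a b => a = P ∧ b = 0

/-- The quotient algebra ℂ⟨x,y⟩/⟨P⟩. -/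
abbrev AlgQ (P : F2) : Type := RingQuot (Prel P)

/-- The quotient map ℂ⟨x,y⟩ → ℂ⟨x,y⟩/⟨P⟩. -/
def qmap (P : F2) : F2 →ₐ[ℂ] AlgQ P := RingQuot.mkAlgHom ℂ (Prel P)

/-- Lower central series: `lcs A i` is `L_{i+1}(A)`, so `lcs A 0 = L₁(A) = A`,
and `L_{i+2}(A)` is the ℂ-linear span of all `[a,u] = a*u - u*a` with `u ∈ L_{i+1}(A)`. -/
def lcs (A : Type) [Ring A] [Algebra ℂ A] : ℕ → Submodule ℂ A
  | 0 => ⊤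
  | n + 1 => Submodule.span ℂ {x | ∃ a u, u ∈ lcs A n ∧ x = a * u - u * a}

/-- L₃(A) viewed as a submodule of L₂(A). -/
def L3sub (A : Type) [Ring A] [Algebra ℂ A] : Submodule ℂ ↥(lcs A 1) :=
  (lcs A 2).comap (lcs A 1).subtype

/-- B₂(A) = L₂(A)/L₃(A). -/
abbrev B2 (A : Type) [Ring A] [Algebra ℂ A] : Type := ↥(lcs A 1) ⧸ L3sub A

/-- The weight of a word in x,y, where x has weight s and y has weight r. -/
def wordWt (s r : ℕ) (w : List (Fin 2)) : ℕ :=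
  (w.map (fun i => if i = 0 then s else r)).sum

/-- The degree-m homogeneous component of ℂ⟨x,y⟩ for the weighted grading
(deg x = s, deg y = r): the span of the monomials of weight m. -/
def degSub (s r m : ℕ) : Submodule ℂ F2 :=
  Submodule.span ℂ {P | ∃ w : List (Fin 2), wordWt s r w = m ∧ P = (w.map (FreeAlgebra.ι ℂ)).prod}


open MvPolynomial

section CommutatorClass

variable {A : Type} [Ring A] [Algebra ℂ A]

/-- The class of the commutator `[a, b]` modulo `L₃(A)`, as a bilinear map. -/
def commClass (A : Type) [Ring A] [Algebra ℂ A] : A →ₗ[ℂ] A →ₗ[ℂ] A ⧸ lcs A 2 :=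
  (LinearMap.mul ℂ A - (LinearMap.mul ℂ A).flip).compr₂ (lcs A 2).mkQ

lemma commClass_apply (a b : A) : commClass A a b = (lcs A 2).mkQ (a * b - b * a) := rfl

lemma commutator_mem_lcs_one (a b : A) : a * b - b * a ∈ lcs A 1 :=
  Submodule.subset_span ⟨a, b, Submodule.mem_top, rfl⟩

lemma commClass_swap (a b : A) : commClass A a b = -commClass A b a := by
  rw [commClass_apply, commClass_apply, ← map_neg, neg_sub]

lemma commClass_mul_comm (a b c : A) : commClass A (a * b) c = commClass A (b * a) c := by
  rw [commClass_swap, commClass_swap (b * a), neg_inj, ← sub_eq_zero, ← map_sub, commClass_apply,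
    Submodule.mkQ_apply, Submodule.Quotient.mk_eq_zero]
  exact Submodule.subset_span ⟨c, _, commutator_mem_lcs_one a b, rfl⟩

lemma commClass_mul_right (a b c : A) :
    commClass A a (b * c) = commClass A (a * b) c + commClass A (c * a) b := by
  simp only [commClass_apply, ← map_add]
  congr 1
  noncomm_ring

lemma commClass_pow_right (u x : A) (n : ℕ) :
    commClass A u (x ^ (n + 1)) = ((n : ℂ) + 1) • commClass A (u * x ^ n) x := by
  induction n generalizing u with
  | zero => simp
  | succ n ih =>
    rw [pow_succ, commClass_mul_right, ih (x * u), mul_assoc x, commClass_mul_comm x, mul_assoc,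
      ← pow_succ]
    push_cast
    module

lemma commClass_mul_pow (u x : A) (n : ℕ) :
    commClass A (u * x ^ n) x = ((n : ℂ) + 1)⁻¹ • commClass A u (x ^ (n + 1)) := by
  rw [commClass_pow_right, inv_smul_smul₀ (Nat.cast_add_one_ne_zero n)]

lemma commClass_exchange (a b x y : A) :
    commClass A (a * (x * y) * b) x = commClass A (a * (y * x) * b) x := by
  have key (u : A) : commClass A (u * x * y) x = commClass A (u * y * x) x := by
    have h1 := commClass_mul_pow (y * u) x 1
    have h2 := commClass_mul_pow (u * y) x 1
    rw [pow_one] at h1 h2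
    rw [commClass_mul_comm (u * x), ← mul_assoc, h1, h2, commClass_mul_comm]
  rw [commClass_mul_comm _ b, commClass_mul_comm _ b]
  simpa only [mul_assoc] using key (b * a)

lemma apply_mul_pow_of_exchange {R M : Type*} [Monoid R] (f : R → M) (x y : R)
    (hf : ∀ a b, f (a * (x * y) * b) = f (a * (y * x) * b)) (a b : R) (p : ℕ) :
    f (a * y * x ^ p * b) = f (a * x ^ p * y * b) := by
  induction p generalizing a with
  | zero => simp
  | succ p ih =>
    have h := hf a (x ^ p * b)
    simp only [pow_succ', mul_assoc] at h ih ⊢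
    rw [← h]
    simpa only [mul_assoc] using ih (a * x)

end CommutatorClass

/-- The generator `x` of `ℂ⟨x,y⟩`. -/
local notation "𝐱" => FreeAlgebra.ι ℂ (0 : Fin 2)

/-- The generator `y` of `ℂ⟨x,y⟩`. -/
local notation "𝐲" => FreeAlgebra.ι ℂ (1 : Fin 2)

lemma FreeAlgebra.submodule_eq_top_of_mul_ι_mem {R X : Type*} [CommRing R]
    (W : Submodule R (FreeAlgebra R X)) (one_mem : 1 ∈ W)
    (mul_mem : ∀ w ∈ W, ∀ i, w * FreeAlgebra.ι R i ∈ W) : W = ⊤ := by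
  have key (a : FreeAlgebra R X) : ∀ w ∈ W, w * a ∈ W := by
    induction a using FreeAlgebra.induction with
    | grade0 r =>
      intro w hw
      rw [← Algebra.commutes, ← Algebra.smul_def]
      exact W.smul_mem r hw
    | grade1 i => exact fun w hw => mul_mem w hw i
    | mul a b ha hb =>
      intro w hw
      rw [← mul_assoc]
      exact hb _ (ha w hw)
    | add a b ha hb =>
      intro w hw
      rw [mul_add]
      exact W.add_mem (ha w hw) (hb w hw)
  exact eq_top_iff.2 fun a _ => by simpa using key a 1 one_mem

lemma mem_of_exchange {M : Type*} [AddCommGroup M] [Module ℂ M] (N : Submodule ℂ M)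
    (f : F2 →ₗ[ℂ] M) (hf : ∀ a b, f (a * (𝐱 * 𝐲) * b) = f (a * (𝐲 * 𝐱) * b))
    (hN : ∀ p q : ℕ, f (𝐱 ^ p * 𝐲 ^ q) ∈ N) (w : F2) : f w ∈ N := by
  let W : Submodule ℂ F2 :=
    ⨅ p : ℕ, ⨅ q : ℕ, N.comap (f ∘ₗ LinearMap.mulRight ℂ (𝐱 ^ p * 𝐲 ^ q))
  have mem_W (w : F2) : w ∈ W ↔ ∀ p q : ℕ, f (w * (𝐱 ^ p * 𝐲 ^ q)) ∈ N := by
    simp [W, Submodule.mem_iInf, mul_assoc]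
  have hW : W = ⊤ := by
    refine FreeAlgebra.submodule_eq_top_of_mul_ι_mem W ?_ ?_
    · simpa [mem_W] using hN
    · intro w hw i
      rw [mem_W] at hw ⊢
      intro p q
      fin_cases i
      · simpa [pow_succ', mul_assoc] using hw (p + 1) q
      · have h := apply_mul_pow_of_exchange f 𝐱 𝐲 hf w (𝐲 ^ q) p
        simp only [mul_assoc] at h
        simpa [h, pow_succ', mul_assoc] using hw p (q + 1)
  have hw : w ∈ W := hW ▸ Submodule.mem_top
  simpa using (mem_W w).1 hw 0 0

lemma commClass_mem (N : Submodule ℂ (F2 ⧸ lcs F2 2))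
    (hN : ∀ p q : ℕ, commClass F2 (𝐱 ^ (p + 1)) (𝐲 ^ (q + 1)) ∈ N) (a b : F2) :
    commClass F2 a b ∈ N := by
  have commClass_one (c : F2) : commClass F2 1 c = 0 := by simp [commClass_apply]
  induction b using FreeAlgebra.induction generalizing a with
  | grade0 r => simp [commClass_apply, Algebra.commutes r a]
  | grade1 i =>
    fin_cases i
    · refine mem_of_exchange N ((commClass F2).flip 𝐱)
        (fun a b => commClass_exchange a b 𝐱 𝐲) (fun p q => ?_) a
      rw [LinearMap.flip_apply, commClass_mul_comm, commClass_mul_pow]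
      refine N.smul_mem _ ?_
      cases q with
      | zero => simp [commClass_one]
      | succ q =>
        rw [commClass_swap]
        exact N.neg_mem (hN p q)
    · refine mem_of_exchange N ((commClass F2).flip 𝐲)
        (fun a b => (commClass_exchange a b 𝐲 𝐱).symm) (fun p q => ?_) a
      rw [LinearMap.flip_apply, commClass_mul_pow]
      refine N.smul_mem _ ?_
      cases p with
      | zero => simp [commClass_one]
      | succ p => exact hN p q
  | mul b c hb hc =>
    rw [commClass_mul_right]
    exact N.add_mem (hc _) (hb _)
  | add b c hb hc =>
    rw [map_add]
    exact N.add_mem (hb _) (hc _)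

/-- The representation of `ℂ⟨x,y⟩` by upper triangular matrices over `ℂ[x,y]` whose
superdiagonal entries are the partial derivatives of the abelianization. -/
def jetRep : F2 →ₐ[ℂ] Matrix (Fin 3) (Fin 3) (MvPolynomial (Fin 2) ℂ) :=
  FreeAlgebra.lift ℂ ![!![X 0, 1, 0; 0, X 0, 0; 0, 0, X 0], !![X 1, 0, 0; 0, X 1, 1; 0, 0, X 1]]

/-- The upper right entry of `jetRep`. -/
def jetCorner : F2 →ₗ[ℂ] MvPolynomial (Fin 2) ℂ :=
  Matrix.entryLinearMap ℂ (MvPolynomial (Fin 2) ℂ) 0 2 ∘ₗ jetRep.toLinearMap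

lemma jetCorner_apply (a : F2) : jetCorner a = jetRep a 0 2 := rfl

lemma abmap_ι (i : Fin 2) : abmap (FreeAlgebra.ι ℂ i) = X i := by simp [abmap]

lemma jetRep_eq (a : F2) :
    jetRep a = !![abmap a, pderiv 0 (abmap a), jetCorner a;
      0, abmap a, pderiv 1 (abmap a); 0, 0, abmap a] := by
  suffices h : ∃ g, jetRep a = !![abmap a, pderiv 0 (abmap a), g;
      0, abmap a, pderiv 1 (abmap a); 0, 0, abmap a] by
    obtain ⟨g, hg⟩ := h
    have : jetCorner a = g := by rw [jetCorner_apply, hg]; rfl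
    rw [this, hg]
  induction a using FreeAlgebra.induction with
  | grade0 r =>
    refine ⟨0, ?_⟩
    ext1 i j
    fin_cases i <;> fin_cases j <;>
      simp [Matrix.algebraMap_matrix_apply, MvPolynomial.algebraMap_eq]
  | grade1 i =>
    refine ⟨0, ?_⟩
    fin_cases i <;> simp [jetRep, abmap_ι, pderiv_X]
  | mul a b ha hb =>
    obtain ⟨g, hg⟩ := ha
    obtain ⟨k, hk⟩ := hb
    refine ⟨abmap a * k + pderiv 0 (abmap a) * pderiv 1 (abmap b) + g * abmap b, ?_⟩
    rw [map_mul, hg, hk]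
    ext1 i j
    fin_cases i <;> fin_cases j <;>
      simp [Matrix.mul_apply, Fin.sum_univ_three, Derivation.leibniz, mul_comm]
  | add a b ha hb =>
    obtain ⟨g, hg⟩ := ha
    obtain ⟨k, hk⟩ := hb
    refine ⟨g + k, ?_⟩
    rw [map_add, hg, hk]
    ext1 i j
    fin_cases i <;> fin_cases j <;> simp

lemma jetCorner_mul (a b : F2) :
    jetCorner (a * b) = abmap a * jetCorner b + pderiv 0 (abmap a) * pderiv 1 (abmap b)
      + jetCorner a * abmap b := by
  rw [jetCorner_apply (a * b), map_mul, jetRep_eq a, jetRep_eq b]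
  simp [Matrix.mul_apply, Fin.sum_univ_three]

lemma jetCorner_commutator (a b : F2) :
    jetCorner (a * b - b * a) = pderiv 0 (abmap a) * pderiv 1 (abmap b)
      - pderiv 0 (abmap b) * pderiv 1 (abmap a) := by
  rw [map_sub, jetCorner_mul, jetCorner_mul]
  ring

lemma jetCorner_commutator_pow (i j : ℕ) :
    jetCorner (𝐱 ^ i * 𝐲 ^ j - 𝐲 ^ j * 𝐱 ^ i) =
      (i : MvPolynomial (Fin 2) ℂ) * (j : MvPolynomial (Fin 2) ℂ) * X 0 ^ (i - 1) *
        X 1 ^ (j - 1) := by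
  rw [jetCorner_commutator]
  simp only [map_pow, abmap_ι, pderiv_pow, pderiv_X]
  simp
  ring

lemma abmap_eq_zero_of_mem {u : F2} (hu : u ∈ lcs F2 1) : abmap u = 0 := by
  have h : lcs F2 1 ≤ LinearMap.ker abmap.toLinearMap := by
    refine Submodule.span_le.2 ?_
    rintro _ ⟨a, b, -, rfl⟩
    simp [mul_comm]
  exact h hu

lemma jetCorner_eq_zero_of_mem {u : F2} (hu : u ∈ lcs F2 2) : jetCorner u = 0 := by
  have h : lcs F2 2 ≤ LinearMap.ker jetCorner := by
    refine Submodule.span_le.2 ?_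
    rintro _ ⟨a, b, hb, rfl⟩
    simp [jetCorner_commutator, abmap_eq_zero_of_mem hb, -map_sub]
  exact h hu

/-- The linear map sending `x ^ p * y ^ q` to `[x ^ (p + 1), y ^ (q + 1)] / ((p + 1) * (q + 1))`. -/
def commLift : MvPolynomial (Fin 2) ℂ →ₗ[ℂ] F2 :=
  (basisMonomials (Fin 2) ℂ).constr ℂ fun m =>
    (((m 0 : ℂ) + 1) * ((m 1 : ℂ) + 1))⁻¹ •
      (𝐱 ^ (m 0 + 1) * 𝐲 ^ (m 1 + 1) - 𝐲 ^ (m 1 + 1) * 𝐱 ^ (m 0 + 1))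

lemma commLift_monomial (m : Fin 2 →₀ ℕ) :
    commLift (monomial m 1) = (((m 0 : ℂ) + 1) * ((m 1 : ℂ) + 1))⁻¹ •
      (𝐱 ^ (m 0 + 1) * 𝐲 ^ (m 1 + 1) - 𝐲 ^ (m 1 + 1) * 𝐱 ^ (m 0 + 1)) := by
  have h : monomial m (1 : ℂ) = basisMonomials (Fin 2) ℂ m := by rw [coe_basisMonomials]
  rw [commLift, h, Module.Basis.constr_basis]

lemma natCast_add_one_mul_ne_zero (p q : ℕ) : ((p : ℂ) + 1) * ((q : ℂ) + 1) ≠ 0 :=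
  mul_ne_zero (Nat.cast_add_one_ne_zero p) (Nat.cast_add_one_ne_zero q)

lemma jetCorner_commLift (P : MvPolynomial (Fin 2) ℂ) : jetCorner (commLift P) = P := by
  suffices h : jetCorner ∘ₗ commLift = LinearMap.id from LinearMap.congr_fun h P
  refine (basisMonomials (Fin 2) ℂ).ext fun m => ?_
  rw [coe_basisMonomials, LinearMap.comp_apply, commLift_monomial, map_smul,
    jetCorner_commutator_pow, LinearMap.id_apply,
    inv_smul_eq_iff₀ (natCast_add_one_mul_ne_zero _ _)]
  beta_reduce
  rw [monomial_eq, Finsupp.prod_fintype _ _ (by simp)]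
  simp [Fin.prod_univ_two, smul_eq_C_mul, mul_assoc]

lemma commLift_mem (P : MvPolynomial (Fin 2) ℂ) : commLift P ∈ lcs F2 1 := by
  induction P using MvPolynomial.induction_on' with
  | monomial m r =>
    rw [← mul_one r, ← smul_eq_mul, ← smul_monomial, map_smul, commLift_monomial]
    exact Submodule.smul_mem _ _ (Submodule.smul_mem _ _ (commutator_mem_lcs_one _ _))
  | add P Q hP hQ =>
    rw [map_add]
    exact Submodule.add_mem _ hP hQ

lemma sub_commLift_jetCorner_mem {u : F2} (hu : u ∈ lcs F2 1) :
    u - commLift (jetCorner u) ∈ lcs F2 2 := by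
  have h : lcs F2 1 ≤ (LinearMap.range ((lcs F2 2).mkQ ∘ₗ commLift)).comap (lcs F2 2).mkQ := by
    refine Submodule.span_le.2 ?_
    rintro _ ⟨a, b, -, rfl⟩
    refine commClass_mem (LinearMap.range ((lcs F2 2).mkQ ∘ₗ commLift)) (fun p q => ?_) a b
    refine ⟨(((p : ℂ) + 1) * ((q : ℂ) + 1)) •
      monomial (Finsupp.single 0 p + Finsupp.single 1 q) 1, ?_⟩
    rw [LinearMap.comp_apply, map_smul, commLift_monomial]
    have h0 : (Finsupp.single 0 p + Finsupp.single 1 q : Fin 2 →₀ ℕ) 0 = p := by simp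
    have h1 : (Finsupp.single 0 p + Finsupp.single 1 q : Fin 2 →₀ ℕ) 1 = q := by simp
    rw [h0, h1, smul_inv_smul₀ (natCast_add_one_mul_ne_zero p q), commClass_apply]
  obtain ⟨P, hP⟩ := h hu
  have hmem : u - commLift P ∈ lcs F2 2 := by
    rw [← Submodule.Quotient.eq]
    exact hP.symm
  have hc := jetCorner_eq_zero_of_mem hmem
  rw [map_sub, jetCorner_commLift, sub_eq_zero] at hc
  rwa [hc]

/-- The linear map `B₂(ℂ⟨x,y⟩) → ℂ[x,y]` induced by `jetCorner`. -/
def b2Map : B2 F2 →ₗ[ℂ] MvPolynomial (Fin 2) ℂ :=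
  (L3sub F2).liftQ (jetCorner ∘ₗ (lcs F2 1).subtype) fun _ hu => jetCorner_eq_zero_of_mem hu

lemma b2Map_mk (u : lcs F2 1) : b2Map (Submodule.Quotient.mk u) = jetCorner u := rfl

lemma b2Map_bijective : Function.Bijective b2Map := by
  refine ⟨(injective_iff_map_eq_zero b2Map).2 fun b hb => ?_,
    fun P => ⟨Submodule.Quotient.mk ⟨commLift P, commLift_mem P⟩, jetCorner_commLift P⟩⟩
  induction b using Submodule.Quotient.induction_on with
  | _ u =>
    rw [b2Map_mk] at hb
    rw [Submodule.Quotient.mk_eq_zero]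
    simpa [hb, L3sub] using sub_commLift_jetCorner_mem u.2

/-- there is a ℂ-linear isomorphism B₂(ℂ⟨x,y⟩) ≃ ℂ[x,y] sending the class
of [xⁱ, yʲ] to i·j·x^{i-1}·y^{j-1} for all i, j ≥ 1. -/
theorem stmt5 :
    ∃ φ : B2 F2 ≃ₗ[ℂ] MvPolynomial (Fin 2) ℂ,
      ∀ i j : ℕ, 1 ≤ i → 1 ≤ j →
        ∀ h : (FreeAlgebra.ι ℂ (0 : Fin 2)) ^ i * (FreeAlgebra.ι ℂ (1 : Fin 2)) ^ j
              - (FreeAlgebra.ι ℂ (1 : Fin 2)) ^ j * (FreeAlgebra.ι ℂ (0 : Fin 2)) ^ i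
                ∈ lcs F2 1,
          φ (Submodule.Quotient.mk (p := L3sub F2) ⟨_, h⟩) =
            (i : MvPolynomial (Fin 2) ℂ) * (j : MvPolynomial (Fin 2) ℂ) *
              MvPolynomial.X 0 ^ (i - 1) * MvPolynomial.X 1 ^ (j - 1) := by
  exact ⟨LinearEquiv.ofBijective b2Map b2Map_bijective,
    fun i j _ _ _ => jetCorner_commutator_pow i j⟩
end
end
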